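/- For the surface F = z^3 − (y − xz)^2 in C^3 with projection (x,y,z) ↦ (x,y), the conductor of the local ring at the origin of the apparent contour {y^3(4x^3 − 27y) = 0} in the (semi-)local ring of the contour {F = ∂_z F = 0} is equal to the mixed jacobian ideal ∂(⟨4x^3−27y⟩, ⟨y⟩^3..., precisely: C_q = ∂(Id(B_1), Id(C_E), −9, M^2), where Id(B_1) = ⟨4x^3 − 27y⟩, Id(C_E) = ⟨y⟩, and M = ⟨x,y⟩. -/

import Mathlib

open MvPolynomial

/-- The Jacobian determinant `∂(F,H)/∂(x,y)` of two polynomials in `ℂ[x,y]`. -/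
noncomputable def jacDet (F H : MvPolynomial (Fin 2) ℂ) : MvPolynomial (Fin 2) ℂ :=
  pderiv 0 F * pderiv 1 H - pderiv 1 F * pderiv 0 H

/-- The mixed jacobian ideal `∂(I,J,λ,K)`: the ideal generated by all
`(∂(F,H)/∂(x,y))·G + λ·F·(∂(G,H)/∂(x,y))` with `F ∈ I`, `G ∈ J`, `H ∈ K`. -/
noncomputable def mixedJacobianIdeal (I J : Ideal (MvPolynomial (Fin 2) ℂ)) (lam : ℂ)
    (K : Ideal (MvPolynomial (Fin 2) ℂ)) : Ideal (MvPolynomial (Fin 2) ℂ) :=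
  Ideal.span {h | ∃ F ∈ I, ∃ G ∈ J, ∃ H ∈ K,
    h = jacDet F H * G + C lam * (F * jacDet G H)}

/-- Membership in an ideal of `ℂ[x,y]` localized at the origin: `A` belongs to `I` locally
at the origin iff `u·A ∈ I` for some `u` not vanishing at the origin. -/
def memAtOrigin (A : MvPolynomial (Fin 2) ℂ) (I : Ideal (MvPolynomial (Fin 2) ℂ)) : Prop :=
  ∃ u : MvPolynomial (Fin 2) ℂ, eval (0 : Fin 2 → ℂ) u ≠ 0 ∧ u * A ∈ I


namespace CuspCase

abbrev P2 := MvPolynomial (Fin 2) ℂ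
abbrev P3 := MvPolynomial (Fin 3) ℂ

/-- the constant `1/3` -/
noncomputable def t : P2 := C (1/3)

lemma ht : (3 : P2) * t = 1 := by
  have : (3 : P2) = C 3 := (map_ofNat C 3).symm
  rw [t, this, ← C_mul]; norm_num

noncomputable def g1 : P2 := X 0 ^ 4 - 6 * X 0 * X 1
noncomputable def g2 : P2 := 2 * X 0 ^ 3 * X 1 - 9 * X 1 ^ 2

/-- the explicit conductor -/
noncomputable def J : Ideal P2 := Ideal.span {g1, g2}

lemma mem_J {A : P2} (a b : P2) (h : A = a * g1 + b * g2) : A ∈ J :=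
  Ideal.mem_span_pair.2 ⟨a, b, h.symm⟩

lemma T4_mem : X 0 * X 1 * (4 * X 0 ^ 3 - 27 * X 1) ∈ J :=
  mem_J (6 * X 1) (-X 0) (by rw [g1, g2]; ring)

lemma xyy_mem : (X 0 * X 1 ^ 2 : P2) ∈ J :=
  mem_J (-2 * X 1 * t) (X 0 * t)
    (by rw [g1, g2]; linear_combination (-(X 0 * X 1 ^ 2 : P2)) * ht)

lemma y3_mem : (X 1 ^ 3 : P2) ∈ J := by
  have h : (X 1 ^ 3 : P2) = 2 * X 0 ^ 2 * t ^ 2 * (X 0 * X 1 ^ 2) + (-X 1 * t ^ 2) * g2 := by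
    rw [g2]; linear_combination (-(X 1 ^ 3 : P2)) * (1 + 3 * t) * ht
  rw [h]
  exact J.add_mem (J.mul_mem_left _ xyy_mem) (J.mul_mem_left _ (mem_J 0 1 (by ring)))

lemma x7_mem : (X 0 ^ 7 : P2) ∈ J := by
  have h : (X 0 ^ 7 : P2) = 36 * (X 0 * X 1 ^ 2) + (X 0 ^ 3 + 6 * X 1) * g1 := by
    rw [g1]; ring
  rw [h]
  exact J.add_mem (J.mul_mem_left _ xyy_mem) (J.mul_mem_left _ (mem_J 1 0 (by ring)))

lemma T5_mem : X 1 * X 1 * (4 * X 0 ^ 3 - 27 * X 1) ∈ J := by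
  have h : (X 1 * X 1 * (4 * X 0 ^ 3 - 27 * X 1) : P2)
      = 4 * X 0 ^ 2 * (X 0 * X 1 ^ 2) + (-27) * X 1 ^ 3 := by ring
  rw [h]
  exact J.add_mem (J.mul_mem_left _ xyy_mem) (J.mul_mem_left _ y3_mem)

lemma exists_vars (v : P2) : ∃ p q : P2, v = C (eval (0 : Fin 2 → ℂ) v) + (X 0 * p + X 1 * q) := by
  induction v using MvPolynomial.induction_on with
  | C a => exact ⟨0, 0, by simp⟩
  | add f g hf hg =>
    obtain ⟨p, q, h⟩ := hf
    obtain ⟨p', q', h'⟩ := hg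
    refine ⟨p + p', q + q', ?_⟩
    rw [map_add, C_add]
    linear_combination h + h'
  | mul_X f i _ =>
    fin_cases i
    · exact ⟨f, 0, by simp [mul_comm]⟩
    · exact ⟨0, f, by simp [mul_comm]⟩

lemma mem_of_local {A v : P2} (hv : eval (0 : Fin 2 → ℂ) v ≠ 0) (h : v * A ∈ J) : A ∈ J := by
  obtain ⟨p, q, e⟩ := exists_vars v
  set c := eval (0 : Fin 2 → ℂ) v
  have hm : (-(X 0 * p + X 1 * q)) ^ 9 ∈ J := by
    rw [neg_pow]
    refine J.mul_mem_left _ (Ideal.add_pow_mem_of_pow_mem_of_le J (m := 7) (n := 3) ?_ ?_ (by norm_num))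
    · rw [mul_pow]; exact J.mul_mem_right _ x7_mem
    · rw [mul_pow]; exact J.mul_mem_right _ y3_mem
  obtain ⟨w, hw⟩ := sub_dvd_pow_sub_pow (C c : P2) (-(X 0 * p + X 1 * q)) 9
  rw [sub_neg_eq_add, ← e] at hw
  have hc : (C c : P2) ^ 9 * A ∈ J := by
    have : (C c : P2) ^ 9 * A = w * (v * A) + A * (-(X 0 * p + X 1 * q)) ^ 9 := by
      linear_combination A * hw
    rw [this]
    exact J.add_mem (J.mul_mem_left _ h) (J.mul_mem_left _ hm)
  have h1 : A = (C c⁻¹ : P2) ^ 9 * ((C c : P2) ^ 9 * A) := by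
    rw [← mul_assoc, ← mul_pow, ← C_mul, inv_mul_cancel₀ hv]; simp
  rw [h1]
  exact J.mul_mem_left _ hc

lemma pd00 : pderiv (0 : Fin 2) (X 0 : P2) = 1 := pderiv_X_self _
lemma pd11 : pderiv (1 : Fin 2) (X 1 : P2) = 1 := pderiv_X_self _
lemma pd01 : pderiv (0 : Fin 2) (X 1 : P2) = 0 := pderiv_X_of_ne (by decide)
lemma pd10 : pderiv (1 : Fin 2) (X 0 : P2) = 0 := pderiv_X_of_ne (by decide)
lemma pdn (i : Fin 2) (n : ℕ) [n.AtLeastTwo] : pderiv i (OfNat.ofNat n : P2) = 0 := by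
  rw [← map_ofNat (C : ℂ →+* P2) n]; exact pderiv_C
lemma pdn4 (i : Fin 2) : pderiv i (4 : P2) = 0 := pdn i 4
lemma pdn27 (i : Fin 2) : pderiv i (27 : P2) = 0 := pdn i 27

lemma mixed_eq : mixedJacobianIdeal (Ideal.span {4 * X 0 ^ 3 - 27 * X 1}) (Ideal.span {X 1}) (-9)
            ((Ideal.span {X 0, X 1}) ^ 2)
          ⊔ Ideal.span {X 1 ^ 3 * (4 * X 0 ^ 3 - 27 * X 1)} = J := by
  have h9 : (C (-9) : P2) = -9 := by rw [C_neg]; rw [map_ofNat]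
  apply le_antisymm
  · apply sup_le
    · refine Ideal.span_le.2 ?_
      rintro h ⟨F, hF, G, hG, H, hH, rfl⟩
      obtain ⟨a, rfl⟩ := Ideal.mem_span_singleton'.1 hF
      obtain ⟨b, rfl⟩ := Ideal.mem_span_singleton'.1 hG
      have : ∃ p q r : P2, H = X 0 ^ 2 * p + X 0 * X 1 * q + X 1 ^ 2 * r := by
        rw [pow_two, Ideal.span_pair_mul_span_pair] at hH
        simp only [Ideal.mem_span_insert, Ideal.mem_span_singleton'] at hH
        obtain ⟨p, _, ⟨q, _, ⟨q', _, ⟨r, rfl⟩, rfl⟩, rfl⟩, rfl⟩ := hH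
        exact ⟨p, q + q', r, by ring⟩
      obtain ⟨p, q, r, rfl⟩ := this
      have T1 : X 0 * (3 * X 0 ^ 3 - 18 * X 1) ∈ J := mem_J 3 0 (by rw [g1, g2]; ring)
      have T2 : X 0 * (X 0 ^ 2 * X 1) + X 1 * (3 * X 0 ^ 3 - 18 * X 1) ∈ J :=
        mem_J 0 2 (by rw [g1, g2]; ring)
      have T3 : X 1 * (X 0 ^ 2 * X 1) ∈ J := by
        have : (X 1 * (X 0 ^ 2 * X 1) : P2) = X 0 * (X 0 * X 1 ^ 2) := by ring
        rw [this]; exact J.mul_mem_left _ xyy_mem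
      have key : ∀ c1 c2 c3 c4 c5 : P2, c1 * (X 0 * (3 * X 0 ^ 3 - 18 * X 1))
          + c2 * (X 0 * (X 0 ^ 2 * X 1) + X 1 * (3 * X 0 ^ 3 - 18 * X 1))
          + c3 * (X 1 * (X 0 ^ 2 * X 1)) + c4 * (X 0 * X 1 * (4 * X 0 ^ 3 - 27 * X 1))
          + c5 * (X 1 * X 1 * (4 * X 0 ^ 3 - 27 * X 1)) ∈ J := fun c1 c2 c3 c4 c5 =>
        J.add_mem (J.add_mem (J.add_mem (J.add_mem (J.mul_mem_left _ T1) (J.mul_mem_left _ T2))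
          (J.mul_mem_left _ T3)) (J.mul_mem_left _ T4_mem)) (J.mul_mem_left _ T5_mem)
      set px := pderiv 0 p with hpx
      set py := pderiv 1 p with hpy
      set qx := pderiv 0 q with hqx
      set qy := pderiv 1 q with hqy
      set rx := pderiv 0 r with hrx
      set ry := pderiv 1 r with hry
      set ax := pderiv 0 a with hax
      set ay := pderiv 1 a with hay
      set bx := pderiv 0 b with hbx
      set By := pderiv 1 b with hby
      rw [SetLike.mem_coe]
      convert key (12 * a * b * (2 * p + X 0 * px + X 1 * qx - X 1 * py))
        (12 * a * b * (q + X 1 * rx + X 0 * py))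
        (12 * a * b * (2 * r - X 0 * rx + X 0 * qy + X 1 * ry))
        ((b * ax - 9 * a * bx) * (q + X 0 * py + X 1 * qy)
          - (b * ay - 9 * a * By) * (2 * p + X 0 * px + X 1 * qx))
        ((b * ax - 9 * a * bx) * (2 * r + X 1 * ry)
          - (b * ay - 9 * a * By) * (q + X 1 * rx)) using 1
      simp only [jacDet, h9, map_add, map_sub, pderiv_mul, pderiv_pow, pd00, pd01, pd10, pd11, pdn4, pdn27,
        ← hpx, ← hpy, ← hqx, ← hqy, ← hrx, ← hry, ← hax, ← hay, ← hbx, ← hby]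
      push_cast
      ring
    · rw [Ideal.span_singleton_le_iff_mem]
      exact J.mul_mem_right _ y3_mem
  · refine le_sup_of_le_left (Ideal.span_le.2 ?_)
    have gen : ∀ H ∈ (Ideal.span {X 0, X 1} : Ideal P2) ^ 2,
        jacDet (4 * X 0 ^ 3 - 27 * X 1) H * X 1
          + C (-9) * ((4 * X 0 ^ 3 - 27 * X 1) * jacDet (X 1) H) ∈
        mixedJacobianIdeal (Ideal.span {4 * X 0 ^ 3 - 27 * X 1}) (Ideal.span {X 1}) (-9)
            ((Ideal.span {X 0, X 1}) ^ 2) := fun H hH =>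
      Ideal.subset_span ⟨_, Ideal.mem_span_singleton_self _, _, Ideal.mem_span_singleton_self _,
        H, hH, rfl⟩
    have hx : (X 0 : P2) ∈ (Ideal.span {X 0, X 1} : Ideal P2) := Ideal.subset_span (by simp)
    have hy : (X 1 : P2) ∈ (Ideal.span {X 0, X 1} : Ideal P2) := Ideal.subset_span (by simp)
    have c72 : (C (1/72) : P2) * 72 = 1 := by
      rw [← map_ofNat (C : ℂ →+* P2) 72, ← C_mul]; norm_num
    have c24 : (C (1/24) : P2) * 24 = 1 := by
      rw [← map_ofNat (C : ℂ →+* P2) 24, ← C_mul]; norm_num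
    rintro g (rfl | rfl)
    · have := Ideal.mul_mem_left _ (C (1/72)) (gen (X 0 * X 0) (by rw [pow_two]; exact Ideal.mul_mem_mul hx hx))
      rw [SetLike.mem_coe]
      convert this using 1
      simp only [jacDet, h9, map_add, map_sub, pderiv_mul, pderiv_pow, pd00, pd01, pd10, pd11, pdn4, pdn27]
      rw [g1]
      push_cast
      linear_combination (-(X 0 ^ 4 - 6 * X 0 * X 1) : P2) * c72
    · have := Ideal.mul_mem_left _ (C (1/24)) (gen (X 0 * X 1) (by rw [pow_two]; exact Ideal.mul_mem_mul hx hy))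
      rw [SetLike.mem_coe]
      convert this using 1
      simp only [jacDet, h9, map_add, map_sub, pderiv_mul, pderiv_pow, pd00, pd01, pd10, pd11, pdn4, pdn27]
      rw [g2]
      push_cast
      linear_combination (-(2 * X 0 ^ 3 * X 1 - 9 * X 1 ^ 2) : P2) * c24

/-- `ℂ[x,y][z]/(F_z)` -/
abbrev Q := QuadraticAlgebra P2 (-2 * t * X 0 * X 1) (2 * t * X 0 ^ 2)

noncomputable def φ : P3 →ₐ[ℂ] Q := aeval ![⟨X 0, 0⟩, ⟨X 1, 0⟩, ⟨0, 1⟩]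

lemma φ0 : φ (X 0) = ⟨X 0, 0⟩ := by simp [φ]
lemma φ1 : φ (X 1) = ⟨X 1, 0⟩ := by simp [φ]
lemma φ2 : φ (X 2) = ⟨0, 1⟩ := by simp [φ]
lemma φC (c : ℂ) : φ (C c) = ⟨C c, 0⟩ := by
  simp only [φ, aeval_C]; rfl

noncomputable abbrev pb : P2 →ₐ[ℂ] P3 := rename Fin.castSucc

lemma pb0 : pb (X 0) = X 0 := by simp [pb]
lemma pb1 : pb (X 1) = X 1 := by simp [pb]

lemma φpb (A : P2) : φ (pb A) = ⟨A, 0⟩ := by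
  induction A using MvPolynomial.induction_on with
  | C a => rw [rename_C, φC]
  | add f g hf hg => rw [map_add, map_add, hf, hg]; ext <;> simp
  | mul_X f i h =>
    rw [map_mul, map_mul, h]
    fin_cases i
    · simp only [Fin.zero_eta]; rw [pb0, φ0]; ext1 <;> simp
    · simp only [Fin.mk_one]; rw [pb1, φ1]; ext1 <;> simp

lemma re_eval (u : P3) : eval (0 : Fin 2 → ℂ) (φ u).re = eval (0 : Fin 3 → ℂ) u := by
  induction u using MvPolynomial.induction_on with
  | C a => rw [φC]; simp
  | add f g hf hg => rw [map_add, QuadraticAlgebra.re_add, map_add, map_add, hf, hg]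
  | mul_X f i h =>
    rw [map_mul]
    fin_cases i
    · simp only [Fin.zero_eta]; rw [φ0]; simp
    · simp only [Fin.mk_one]; rw [φ1]; simp
    · simp only [Fin.reduceFinMk]; rw [φ2]; simp

noncomputable def F : P3 := X 2 ^ 3 - (X 1 - X 0 * X 2) ^ 2
noncomputable def Fz : P3 := 3 * X 2 ^ 2 - 2 * X 0 ^ 2 * X 2 + 2 * X 0 * X 1

lemma Fz_eq : pderiv 2 (X 2 ^ 3 - (X 1 - X 0 * X 2) ^ 2 : P3) = Fz := by
  have h2 : pderiv (2 : Fin 3) (X 2 : P3) = 1 := pderiv_X_self _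
  have h1 : pderiv (2 : Fin 3) (X 1 : P3) = 0 := pderiv_X_of_ne (by decide)
  have h0 : pderiv (2 : Fin 3) (X 0 : P3) = 0 := pderiv_X_of_ne (by decide)
  simp only [map_sub, pderiv_pow, pderiv_mul, h0, h1, h2, Fz]
  push_cast
  ring

lemma φ_three (n : ℕ) [n.AtLeastTwo] : φ (OfNat.ofNat n) = ⟨OfNat.ofNat n, 0⟩ := by
  rw [← map_ofNat (C : ℂ →+* P3) n, φC, map_ofNat]

lemma φFz : φ Fz = 0 := by
  have h3 : φ 3 = ⟨3, 0⟩ := φ_three 3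
  have h2 : φ 2 = ⟨2, 0⟩ := φ_three 2
  simp only [Fz, map_add, map_sub, map_mul, φ0, φ1, φ2, h2, h3, pow_two]
  ext1
  · simp only [QuadraticAlgebra.re_add, QuadraticAlgebra.re_sub, QuadraticAlgebra.re_mul,
      QuadraticAlgebra.im_mul, QuadraticAlgebra.re_zero]
    linear_combination (-2 * X 0 * X 1 : P2) * ht
  · simp only [QuadraticAlgebra.im_add, QuadraticAlgebra.im_sub, QuadraticAlgebra.re_mul,
      QuadraticAlgebra.im_mul, QuadraticAlgebra.im_zero]
    linear_combination (2 * X 0 ^ 2 : P2) * ht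

lemma φF : φ F = ⟨t ^ 2 * g2, -2 * t ^ 2 * g1⟩ := by
  simp only [F, map_sub, map_mul, map_pow, φ0, φ1, φ2, pow_succ, pow_zero, one_mul]
  ext1
  · simp only [QuadraticAlgebra.re_sub, QuadraticAlgebra.re_mul, QuadraticAlgebra.im_sub,
      QuadraticAlgebra.im_mul, g2]
    linear_combination ((3 * t + 1) * X 1 ^ 2 - 2 * t * X 0 ^ 3 * X 1 : P2) * ht
  · simp only [QuadraticAlgebra.re_sub, QuadraticAlgebra.re_mul, QuadraticAlgebra.im_sub,
      QuadraticAlgebra.im_mul, g1]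
    linear_combination (-2 * X 0 * X 1 * (1 + 2 * t) + 2 * t * X 0 ^ 4 : P2) * ht

lemma im_mem {w : P3} (hw : w ∈ Ideal.span {F, Fz}) : (φ w).re ∈ J ∧ (φ w).im ∈ J := by
  obtain ⟨a, b, rfl⟩ := Ideal.mem_span_pair.1 hw
  rw [map_add, map_mul, map_mul, φFz, φF, mul_zero, add_zero]
  have m1 : g1 ∈ J := mem_J 1 0 (by ring)
  have m2 : g2 ∈ J := mem_J 0 1 (by ring)
  constructor
  · rw [QuadraticAlgebra.re_mul]
    exact J.add_mem (J.mul_mem_left _ (J.mul_mem_left _ m2)) (J.mul_mem_left _ (J.mul_mem_left _ m1))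
  · rw [QuadraticAlgebra.im_mul]
    exact J.add_mem (J.add_mem (J.mul_mem_left _ (J.mul_mem_left _ m1))
      (J.mul_mem_left _ (J.mul_mem_left _ m2))) (J.mul_mem_left _ (J.mul_mem_left _ m1))

lemma forward {A A' : P2} {u : P3} (hu : eval (0 : Fin 3 → ℂ) u ≠ 0)
    (h : u * (pb A * X 2 - pb A') ∈ Ideal.span {F, Fz}) : A ∈ J := by
  obtain ⟨hre, him⟩ := im_mem h
  rw [← re_eval] at hu
  rw [map_mul, map_sub, map_mul, φpb, φpb, φ2] at hre him
  set p := (φ u).re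
  set q := (φ u).im
  simp only [QuadraticAlgebra.re_mul, QuadraticAlgebra.im_mul, QuadraticAlgebra.re_sub,
    QuadraticAlgebra.im_sub] at hre him
  apply mem_of_local (v := p ^ 2 + 2 * t * X 0 ^ 2 * p * q + 2 * t * X 0 * X 1 * q ^ 2)
  · simpa using hu
  · convert J.sub_mem (J.mul_mem_left p him) (J.mul_mem_left q hre) using 1
    ring

lemma normal_form (h : P3) : h - (pb (φ h).re + pb (φ h).im * X 2) ∈ Ideal.span {F, Fz} := by
  have hFz : Fz ∈ Ideal.span {F, Fz} := Ideal.subset_span (by simp)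
  have ht3 : (3 : P3) * pb t = 1 := by
    have := congrArg pb ht
    rwa [map_mul, map_one, map_ofNat] at this
  induction h using MvPolynomial.induction_on with
  | C a => rw [φC]; simp
  | add f g hf hg =>
    convert Ideal.add_mem _ hf hg using 1
    simp only [map_add, QuadraticAlgebra.re_add, QuadraticAlgebra.im_add]
    ring
  | mul_X f i hf =>
    rw [map_mul]
    fin_cases i
    · simp only [Fin.zero_eta]; rw [φ0]
      convert Ideal.mul_mem_right (X 0) _ hf using 1
      simp only [QuadraticAlgebra.re_mul, QuadraticAlgebra.im_mul, map_add, map_mul, pb0, map_zero]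
      ring
    · simp only [Fin.mk_one]; rw [φ1]
      convert Ideal.mul_mem_right (X 1) _ hf using 1
      simp only [QuadraticAlgebra.re_mul, QuadraticAlgebra.im_mul, map_add, map_mul, pb1, map_zero]
      ring
    · simp only [Fin.reduceFinMk]; rw [φ2]
      convert Ideal.add_mem _ (Ideal.mul_mem_right (X 2) _ hf)
        (Ideal.mul_mem_left _ (pb t * pb (φ f).im) hFz) using 1
      simp only [QuadraticAlgebra.re_mul, QuadraticAlgebra.im_mul, map_add, map_mul, map_neg,
        map_pow, map_ofNat, pb0, pb1, map_zero, map_one, Fz]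
      linear_combination (-pb (φ f).im * X 2 ^ 2) * ht3

lemma backward {A : P2} (hA : A ∈ J) : ∃ A' : P2, pb A * X 2 - pb A' ∈ Ideal.span {F, Fz} := by
  obtain ⟨a, b, rfl⟩ := Ideal.mem_span_pair.1 hA
  have c2 : (C (1/2) : P3) * 2 = 1 := by
    rw [← map_ofNat (C : ℂ →+* P3) 2, ← C_mul]; norm_num
  have pC : pb (C (1/2)) = C (1/2) := rename_C _ _
  have ht3 : (3 : P3) * pb t = 1 := by
    have := congrArg pb ht
    rwa [map_mul, map_one, map_ofNat] at this
  refine ⟨a * (C (1/2) * g2) + b * (2 * X 0 ^ 2 * X 1 ^ 2), ?_⟩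
  -- r1 = 2 g1 z - g2
  have r1 : (2 * (X 0 ^ 4 - 6 * X 0 * X 1) * X 2 - (2 * X 0 ^ 3 * X 1 - 9 * X 1 ^ 2) : P3)
      ∈ Ideal.span {F, Fz} :=
    Ideal.mem_span_pair.2 ⟨-9, 3 * X 2 - X 0 ^ 2, by rw [F, Fz]; ring⟩
  have r2 : ((2 * X 0 ^ 3 * X 1 - 9 * X 1 ^ 2) * X 2 - 2 * X 0 ^ 2 * X 1 ^ 2 : P3)
      ∈ Ideal.span {F, Fz} := by
    have hFz : Fz ∈ Ideal.span {F, Fz} := Ideal.subset_span (by simp)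
    convert Ideal.add_mem _ (Ideal.mul_mem_left _ (-X 2 + 2 * pb t * X 0 ^ 2) r1)
      (Ideal.mul_mem_left _ (2 * pb t * (X 0 ^ 4 - 6 * X 0 * X 1)) hFz) using 1
    rw [Fz]
    linear_combination (12 * X 0 * X 1 * X 2 ^ 2 + 2 * X 0 ^ 2 * X 1 ^ 2 - 2 * X 0 ^ 4 * X 2 ^ 2 : P3) * ht3
  convert Ideal.add_mem _ (Ideal.mul_mem_left _ (pb a * C (1/2)) r1)
      (Ideal.mul_mem_left _ (pb b) r2) using 1
  simp only [g1, g2, map_add, map_sub, map_mul, map_pow, map_ofNat, pb0, pb1, pC]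
  linear_combination (-pb a * (X 0 ^ 4 - 6 * X 0 * X 1) * X 2) * c2

end CuspCase

/-- For the surface `F = z³ − (y − xz)² = 0` in `ℂ³` with projection
`(x,y,z) ↦ (x,y)`, the conductor of the local ring at the origin of the apparent contour
`{y³(4x³ − 27y) = 0}` in the (semi-)local ring of the contour `{F = ∂_z F = 0}` equals the
mixed jacobian ideal `∂(Id(B₁), Id(C_E), −9, M²)`, where `Id(B₁) = ⟨4x³ − 27y⟩`,
`Id(C_E) = ⟨y⟩` and `M = ⟨x,y⟩`.  The conductor condition on a germ `A` (an element of the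
local ring of the discriminant curve, represented modulo `⟨y³(4x³−27y)⟩`) says that
multiplication by `A` maps the local ring of the contour into the local ring of the
discriminant curve, via the pullback inclusion induced by the projection. -/
theorem cusp_case_conductor_is_mixed_jacobian_ideal :
    letI x : MvPolynomial (Fin 2) ℂ := X 0
    letI y : MvPolynomial (Fin 2) ℂ := X 1
    letI F : MvPolynomial (Fin 3) ℂ := X 2 ^ 3 - (X 1 - X 0 * X 2) ^ 2
    letI Fz : MvPolynomial (Fin 3) ℂ := pderiv 2 F
    letI pb : MvPolynomial (Fin 2) ℂ →ₐ[ℂ] MvPolynomial (Fin 3) ℂ :=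
      rename Fin.castSucc
    ∀ A : MvPolynomial (Fin 2) ℂ,
      -- A is in the conductor of the local ring of the apparent contour at the origin
      -- in the semi-local ring of the contour:
      (∀ Hh : MvPolynomial (Fin 3) ℂ, ∃ A' : MvPolynomial (Fin 2) ℂ,
          ∃ u : MvPolynomial (Fin 3) ℂ, eval (0 : Fin 3 → ℂ) u ≠ 0 ∧
            u * (pb A * Hh - pb A') ∈ Ideal.span {F, Fz})
      ↔
      -- iff A lies (locally at the origin, modulo the equation of the apparent contour)
      -- in the mixed jacobian ideal ∂(⟨4x³−27y⟩, ⟨y⟩, −9, M²):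
      memAtOrigin A
        (mixedJacobianIdeal (Ideal.span {4 * x ^ 3 - 27 * y}) (Ideal.span {y}) (-9)
            ((Ideal.span {x, y}) ^ 2)
          ⊔ Ideal.span {y ^ 3 * (4 * x ^ 3 - 27 * y)}) := by
  intro A
  rw [CuspCase.mixed_eq, CuspCase.Fz_eq]
  constructor
  · intro h
    obtain ⟨A', u, hu, hm⟩ := h (X 2)
    exact ⟨1, by simp, by rw [one_mul]; exact CuspCase.forward hu hm⟩
  · rintro ⟨v, hv, hA⟩ Hh
    obtain ⟨B, hB⟩ := CuspCase.backward (CuspCase.mem_of_local hv hA)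
    refine ⟨A * (CuspCase.φ Hh).re + (CuspCase.φ Hh).im * B, 1, by simp, ?_⟩
    rw [one_mul]
    have := Ideal.add_mem _ (Ideal.mul_mem_left _ (CuspCase.pb A) (CuspCase.normal_form Hh))
      (Ideal.mul_mem_left _ (CuspCase.pb (CuspCase.φ Hh).im) hB)
    change _ ∈ Ideal.span {CuspCase.F, CuspCase.Fz}
    convert this using 1
    simp only [map_add, map_mul]
    ring
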